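/- arXiv:1805.02286 — 7 statements merged into one kernel-verified Lean document; each statement's English description precedes it below -/
import Mathlib

section
/- Let k be a field and A a nonzero associative unital k-algebra generated as a k-algebra by finitely many elements a₁,…,aₙ. If there exists a linear functional λ : A → k whose kernel is a hyperplane of A containing no two-sided ideal other than {0}, then there exists a linear functional S : k⟨x₁,…,xₙ⟩ → k on the free associative algebra on n generators such that A is isomorphic as a k-algebra to the syntactic algebra 𝔄_S = k⟨x₁,…,xₙ⟩ / I_S. -/
/-- A set `J` in a ring is a two-sided ideal: it is an additive subgroup closed under
left and right multiplication by arbitrary ring elements. -/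
def IsTwoSidedIdealSet {A : Type*} [Ring A] (J : Set A) : Prop :=
  (0 : A) ∈ J ∧ (∀ x ∈ J, ∀ y ∈ J, x + y ∈ J) ∧ (∀ x ∈ J, -x ∈ J) ∧
    (∀ a : A, ∀ x ∈ J, a * x ∈ J) ∧ (∀ a : A, ∀ x ∈ J, x * a ∈ J)

/-- The syntactic congruence of a linear functional `S` on a `k`-algebra `R`:
`a` and `b` are identified iff `a - b` lies in the syntactic ideal
`I_S = {x | ∀ u v, S (u * x * v) = 0}`, which is the largest two-sided ideal
contained in `ker S`. -/
def syntacticCon {k R : Type*} [CommRing k] [Ring R] [Algebra k R]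
    (S : R →ₗ[k] k) : RingCon R where
  r a b := ∀ u v : R, S (u * (a - b) * v) = 0
  iseqv :=
    ⟨fun a u v => by simp,
     fun {a b} h u v => by
       have h1 := h u v
       have e : u * (b - a) * v = -(u * (a - b) * v) := by noncomm_ring
       rw [e, map_neg, h1, neg_zero],
     fun {a b c} h1 h2 u v => by
       have e : u * (a - c) * v = u * (a - b) * v + u * (b - c) * v := by noncomm_ring
       rw [e, map_add, h1, h2, add_zero]⟩
  add' := fun {a b c d} h1 h2 u v => by
    have e : u * (a + c - (b + d)) * v = u * (a - b) * v + u * (c - d) * v := by noncomm_ring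
    rw [e, map_add, h1, h2, add_zero]
  mul' := fun {a b c d} h1 h2 u v => by
    have e : u * (a * c - b * d) * v = u * (a - b) * (c * v) + (u * b) * (c - d) * v := by
      noncomm_ring
    rw [e, map_add, h1 u (c * v), h2 (u * b) v, add_zero]

/-- The syntactic algebra `𝔄_S = k⟨X⟩ / I_S` of a formal series `S`: the quotient of the
algebra by the syntactic ideal, realised as the quotient by the syntactic congruence. -/
abbrev SyntacticAlgebra {k R : Type*} [CommRing k] [Ring R] [Algebra k R]
    (S : R →ₗ[k] k) : Type _ :=
  (syntacticCon S).Quotient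

noncomputable instance {k R : Type*} [CommRing k] [Ring R] [Algebra k R]
    (S : R →ₗ[k] k) : Algebra k (SyntacticAlgebra S) :=
  RingHom.toAlgebra' ((syntacticCon S).mk'.comp (algebraMap k R)) (by
    intro c x
    induction x using Quotient.ind
    rename_i y
    show (syntacticCon S).mk' (algebraMap k R c) * (syntacticCon S).mk' y
        = (syntacticCon S).mk' y * (syntacticCon S).mk' (algebraMap k R c)
    rw [← map_mul, ← map_mul, Algebra.commutes])

/-- If `lam` vanishes on no nonzero two-sided ideal, the syntactic congruence of the pullback of `lam`
along a surjection `f` is the kernel congruence of `f`. -/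
theorem syntacticCon_comp_iff {k R A : Type*} [CommRing k] [Ring R] [Algebra k R]
    [Ring A] [Algebra k A] {f : R →ₐ[k] A} (hf : Function.Surjective f) {lam : A →ₗ[k] k}
    (hlam : ∀ J : Set A, IsTwoSidedIdealSet J → J ⊆ {x : A | lam x = 0} → J = {0}) {x y : R} :
    syntacticCon (lam ∘ₗ f.toLinearMap) x y ↔ f x = f y := by
  refine ⟨fun h => ?_, fun h u v => by simp [h]⟩
  have hJ := hlam {z | ∀ u v : A, lam (u * z * v) = 0}
    ⟨by simp,
      fun x hx y hy u v => by rw [mul_add, add_mul, map_add, hx, hy, add_zero],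
      fun x hx u v => by rw [mul_neg, neg_mul, map_neg, hx, neg_zero],
      fun a x hx u v => by rw [← mul_assoc]; exact hx (u * a) v,
      fun a x hx u v => by rw [← mul_assoc, mul_assoc]; exact hx u (a * v)⟩
    fun x hx => by simpa using hx 1 1
  have hmem : f x - f y ∈ {z | ∀ u v : A, lam (u * z * v) = 0} := fun u v => by
    obtain ⟨u, rfl⟩ := hf u
    obtain ⟨v, rfl⟩ := hf v
    simpa using h u v
  rw [hJ] at hmem
  exact sub_eq_zero.mp hmem

/-- If `lam` vanishes on no nonzero two-sided ideal, the syntactic algebra of the pullback of `lam`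
along a surjection is isomorphic to the target. -/
theorem nonempty_algEquiv_syntacticAlgebra_comp {k R A : Type*} [CommRing k] [Ring R] [Algebra k R]
    [Ring A] [Algebra k A] {f : R →ₐ[k] A} (hf : Function.Surjective f) {lam : A →ₗ[k] k}
    (hlam : ∀ J : Set A, IsTwoSidedIdealSet J → J ⊆ {x : A | lam x = 0} → J = {0}) :
    Nonempty (A ≃ₐ[k] SyntacticAlgebra (lam ∘ₗ f.toLinearMap)) := by
  let c := syntacticCon (lam ∘ₗ f.toLinearMap)
  let g : SyntacticAlgebra (lam ∘ₗ f.toLinearMap) →ₐ[k] A :=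
    { c.lift (f : R →+* A) fun _ _ h => (syntacticCon_comp_iff hf hlam).mp h with
      commutes' := fun r => f.commutes r }
  refine ⟨(AlgEquiv.ofBijective g ⟨fun x y h => ?_, fun z => ?_⟩).symm⟩
  · induction x using Quotient.ind
    induction y using Quotient.ind
    exact Quotient.sound ((syntacticCon_comp_iff hf hlam).mpr h)
  · obtain ⟨x, rfl⟩ := hf z
    exact ⟨c.mk' x, rfl⟩

/-- Let `A ≠ 0` be a `k`-algebra generated by finitely many elements `a₁, …, aₙ`.
If there is a linear functional `lam : A → k` whose kernel is a hyperplane of `A`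
containing no two-sided ideal other than `{0}`, then `A` is isomorphic as a `k`-algebra
to the syntactic algebra `𝔄_S = k⟨x₁,…,xₙ⟩ / I_S` of some formal series
`S : k⟨x₁,…,xₙ⟩ → k`. -/
theorem syntactic_of_finitelyGenerated_of_hyperplane
    {k A : Type*} [Field k] [Ring A] [Algebra k A] [Nontrivial A] {n : ℕ}
    (a : Fin n → A) (hgen : Algebra.adjoin k (Set.range a) = ⊤)
    (lam : A →ₗ[k] k)
    (hhyp : Module.finrank k (A ⧸ LinearMap.ker lam) = 1)
    (hlam : ∀ J : Set A, IsTwoSidedIdealSet J → J ⊆ {x : A | lam x = 0} → J = {0}) :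
    ∃ S : FreeAlgebra k (Fin n) →ₗ[k] k, Nonempty (A ≃ₐ[k] SyntacticAlgebra S) := by
  have hf : Function.Surjective (FreeAlgebra.lift k a) := by
    rw [← AlgHom.range_eq_top, ← Algebra.adjoin_range_eq_range_freeAlgebra_lift, hgen]
  exact ⟨_, nonempty_algEquiv_syntacticAlgebra_comp hf hlam⟩
end

section
/- Let k be a field, n a natural number, and S : k⟨x₁,…,xₙ⟩ → k a linear functional on the free associative algebra on n generators. Let A := k⟨x₁,…,xₙ⟩ / I_S be the syntactic algebra of S. If A ≠ 0, then there exists a hyperplane H of A (a codimension-one linear subspace) that contains no two-sided ideal of A other than {0}. -/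
/-- The functional on the syntactic algebra induced by `S`. -/
def syntacticFunctional {k R : Type*} [CommRing k] [Ring R] [Algebra k R]
    (S : R →ₗ[k] k) : SyntacticAlgebra S →ₗ[k] k where
  toFun := Quotient.lift S fun a b h => by
    have h11 : S (1 * (a - b) * 1) = 0 := h 1 1
    simpa [sub_eq_zero] using h11
  map_add' x y := by
    induction x using Quotient.ind
    induction y using Quotient.ind
    exact map_add S _ _
  map_smul' c x := by
    induction x using Quotient.ind
    rename_i y
    change S (algebraMap k R c * y) = c • S y
    rw [← Algebra.smul_def, map_smul]

theorem syntacticFunctional_mk {k R : Type*} [CommRing k] [Ring R] [Algebra k R]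
    (S : R →ₗ[k] k) (a : R) : syntacticFunctional S ((syntacticCon S).mk' a) = S a :=
  rfl

theorem syntacticCon_mk_eq_zero_iff {k R : Type*} [CommRing k] [Ring R] [Algebra k R]
    (S : R →ₗ[k] k) (a : R) :
    (syntacticCon S).mk' a = 0 ↔ ∀ u v : R, S (u * a * v) = 0 := by
  rw [← map_zero (syntacticCon S).mk']
  refine (RingCon.eq (syntacticCon S)).trans ?_
  change (∀ u v : R, S (u * (a - 0) * v) = 0) ↔ _
  simp only [sub_zero]

theorem syntacticFunctional_ne_zero {k R : Type*} [CommRing k] [Ring R] [Algebra k R]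
    (S : R →ₗ[k] k) [Nontrivial (SyntacticAlgebra S)] : syntacticFunctional S ≠ 0 := by
  intro h
  refine one_ne_zero (α := SyntacticAlgebra S) ?_
  rw [← map_one (syntacticCon S).mk', syntacticCon_mk_eq_zero_iff]
  intro u v
  rw [← syntacticFunctional_mk, h, LinearMap.zero_apply]

/-- The kernel of the induced functional contains no nonzero two-sided ideal. -/
theorem IsTwoSidedIdealSet.eq_zero_of_subset_ker_syntacticFunctional
    {k R : Type*} [CommRing k] [Ring R] [Algebra k R] {S : R →ₗ[k] k}
    {J : Set (SyntacticAlgebra S)} (hJ : IsTwoSidedIdealSet J)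
    (hker : J ⊆ (LinearMap.ker (syntacticFunctional S) : Set (SyntacticAlgebra S))) :
    J = {0} := by
  obtain ⟨hzero, -, -, hleft, hright⟩ := hJ
  refine Set.eq_singleton_iff_unique_mem.2 ⟨hzero, fun x hx => ?_⟩
  obtain ⟨a, rfl⟩ := (syntacticCon S).mk'_surjective x
  rw [syntacticCon_mk_eq_zero_iff]
  intro u v
  have hmem := hker (hright ((syntacticCon S).mk' v) _ (hleft ((syntacticCon S).mk' u) _ hx))
  rw [← map_mul, ← map_mul] at hmem
  exact hmem

/-- If the syntactic algebra `𝔄_S = k⟨x₁,…,xₙ⟩ / I_S` of a formal series `S` is nonzero,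
then it contains a hyperplane (a codimension-one linear subspace) which contains no
two-sided ideal other than `{0}`. -/
theorem syntacticAlgebra_exists_hyperplane
    {k : Type*} [Field k] {n : ℕ} (S : FreeAlgebra k (Fin n) →ₗ[k] k)
    [Nontrivial (SyntacticAlgebra S)] :
    ∃ H : Submodule k (SyntacticAlgebra S),
      Module.finrank k (SyntacticAlgebra S ⧸ H) = 1 ∧
      ∀ J : Set (SyntacticAlgebra S), IsTwoSidedIdealSet J → J ⊆ (H : Set (SyntacticAlgebra S)) →
        J = {0} := by
  refine ⟨LinearMap.ker (syntacticFunctional S), ?_, fun J hJ hker =>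
    hJ.eq_zero_of_subset_ker_syntacticFunctional hker⟩
  have hsurj := LinearMap.surjective (syntacticFunctional_ne_zero S)
  rw [((syntacticFunctional S).quotKerEquivOfSurjective hsurj).finrank_eq, Module.finrank_self]
end

section
/- Let k be a field, X a finite alphabet, and S : X* → k a formal series, extended to a linear functional on the free associative algebra k⟨X⟩. Then S is recognisable (rational) if and only if the syntactic algebra 𝔄_S = k⟨X⟩ / I_S is a finite-dimensional k-vector space. -/
open scoped Matrix

/-- A formal series (linear functional) `S` on the free associative algebra
`k⟨X⟩ = k[X*]` is recognisable: there is a weighted finite-state automaton, i.e. a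
matrix representation `μ : X* → Mₙ(k)` together with vectors `lam, γ ∈ kⁿ`, such that
`S(w) = lam ⬝ μ(w) ⬝ γ` for every word `w ∈ X*`. -/
def IsRecognisable {k X : Type*} [Field k]
    (S : MonoidAlgebra k (FreeMonoid X) →ₗ[k] k) : Prop :=
  ∃ (n : ℕ) (μ : FreeMonoid X →* Matrix (Fin n) (Fin n) k) (lam γ : Fin n → k),
    ∀ w : FreeMonoid X, S (MonoidAlgebra.of k (FreeMonoid X) w) = lam ⬝ᵥ (μ w).mulVec γ

theorem mk'_syntacticCon_eq_zero_iff {k R : Type*} [CommRing k] [Ring R] [Algebra k R]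
    (S : R →ₗ[k] k) (x : R) :
    (syntacticCon S).mk' x = 0 ↔ ∀ u v : R, S (u * x * v) = 0 := by
  rw [← map_zero (syntacticCon S).mk']
  refine (RingCon.eq (syntacticCon S)).trans ?_
  change (∀ u v : R, S (u * (x - 0) * v) = 0) ↔ _
  simp only [sub_zero]

/-- The quotient map onto the syntactic algebra, as an algebra homomorphism. -/
noncomputable def syntacticMk {k R : Type*} [CommRing k] [Ring R] [Algebra k R]
    (S : R →ₗ[k] k) : R →ₐ[k] SyntacticAlgebra S :=
  { (syntacticCon S).mk' with commutes' := fun _ => rfl }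

theorem syntacticMk_surjective {k R : Type*} [CommRing k] [Ring R] [Algebra k R]
    (S : R →ₗ[k] k) : Function.Surjective (syntacticMk S) :=
  (syntacticCon S).mk'_surjective

theorem syntacticMk_eq_zero_iff {k R : Type*} [CommRing k] [Ring R] [Algebra k R]
    (S : R →ₗ[k] k) (x : R) :
    syntacticMk S x = 0 ↔ ∀ u v : R, S (u * x * v) = 0 :=
  mk'_syntacticCon_eq_zero_iff S x

/-- A linear functional factors through its syntactic algebra. -/
theorem exists_comp_syntacticMk_eq {k R : Type*} [CommRing k] [Ring R] [Algebra k R]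
    (S : R →ₗ[k] k) :
    ∃ T : SyntacticAlgebra S →ₗ[k] k, ∀ x, T (syntacticMk S x) = S x := by
  have hker : LinearMap.ker (syntacticMk S).toLinearMap ≤ LinearMap.ker S := fun x hx => by
    simpa using (syntacticMk_eq_zero_iff S x).1 hx 1 1
  let e := (syntacticMk S).toLinearMap.quotKerEquivOfSurjective (syntacticMk_surjective S)
  refine ⟨(Submodule.liftQ _ S hker).comp e.symm.toLinearMap, fun x => ?_⟩
  have hx : e.symm (syntacticMk S x) = Submodule.Quotient.mk x := by
    rw [LinearEquiv.symm_apply_eq]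
    rfl
  simp [hx]

/-- If a linear functional factors through a finite-dimensional algebra, its syntactic algebra
is finite-dimensional. -/
theorem finite_syntacticAlgebra_of_factors {k R B : Type*} [Field k] [Ring R] [Algebra k R]
    [Ring B] [Algebra k B] [FiniteDimensional k B] (S : R →ₗ[k] k) (φ : R →ₐ[k] B)
    (T : B →ₗ[k] k) (hS : ∀ x, S x = T (φ x)) : FiniteDimensional k (SyntacticAlgebra S) := by
  have hker : LinearMap.ker φ.toLinearMap ≤ LinearMap.ker (syntacticMk S).toLinearMap := by
    intro x hx
    have hx' : φ x = 0 := hx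
    exact (syntacticMk_eq_zero_iff S x).2 fun u v => by simp [hS, hx']
  have : Module.Finite k (R ⧸ LinearMap.ker φ.toLinearMap) :=
    Module.Finite.equiv φ.toLinearMap.quotKerEquivRange.symm
  refine Module.Finite.of_surjective (Submodule.liftQ _ (syntacticMk S).toLinearMap hker) ?_
  rw [← LinearMap.range_eq_top, Submodule.range_liftQ, LinearMap.range_eq_top]
  exact syntacticMk_surjective S

theorem IsRecognisable.finiteDimensional_syntacticAlgebra {k X : Type*} [Field k]
    {S : MonoidAlgebra k (FreeMonoid X) →ₗ[k] k} (hS : IsRecognisable S) :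
    FiniteDimensional k (SyntacticAlgebra S) := by
  obtain ⟨n, μ, lam, γ, h⟩ := hS
  let T : Matrix (Fin n) (Fin n) k →ₗ[k] k :=
    { toFun := fun M => lam ⬝ᵥ M.mulVec γ
      map_add' := fun M N => by rw [Matrix.add_mulVec, dotProduct_add]
      map_smul' := fun c M => by rw [Matrix.smul_mulVec, dotProduct_smul]; rfl }
  let φ := MonoidAlgebra.lift k (Matrix (Fin n) (Fin n) k) (FreeMonoid X) μ
  have hST : S = T.comp φ.toLinearMap := by
    refine MonoidAlgebra.lhom_ext' fun w => LinearMap.ext_ring ?_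
    change S (MonoidAlgebra.of k (FreeMonoid X) w) = T (φ (MonoidAlgebra.of k (FreeMonoid X) w))
    rw [MonoidAlgebra.lift_of]
    exact h w
  exact finite_syntacticAlgebra_of_factors S φ T fun x => by rw [hST]; rfl

theorem isRecognisable_of_finiteDimensional_syntacticAlgebra {k X : Type*} [Field k]
    (S : MonoidAlgebra k (FreeMonoid X) →ₗ[k] k) [FiniteDimensional k (SyntacticAlgebra S)] :
    IsRecognisable S := by
  obtain ⟨T, hT⟩ := exists_comp_syntacticMk_eq S
  let b := Module.finBasis k (SyntacticAlgebra S)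
  refine ⟨_, ((Algebra.leftMulMatrix b).comp (syntacticMk S)).toMonoidHom.comp
    (MonoidAlgebra.of k (FreeMonoid X)), fun i => T (b i), b.repr 1, fun w => ?_⟩
  change _ = _ ⬝ᵥ (Algebra.leftMulMatrix b
    (syntacticMk S (MonoidAlgebra.of k (FreeMonoid X) w))).mulVec (b.repr 1)
  rw [Algebra.leftMulMatrix_mulVec_repr, mul_one, ← hT]
  conv_lhs => rw [← b.sum_repr (syntacticMk S (MonoidAlgebra.of k (FreeMonoid X) w))]
  simp only [map_sum, map_smul, smul_eq_mul, dotProduct, mul_comm]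

/-- A formal series `S` over a finite alphabet `X` is recognisable (rational) if and only
if its syntactic algebra `𝔄_S = k⟨X⟩ / I_S` is a finite-dimensional `k`-vector space. -/
theorem isRecognisable_iff_finiteDimensional_syntacticAlgebra
    {k X : Type*} [Field k] [Fintype X]
    (S : MonoidAlgebra k (FreeMonoid X) →ₗ[k] k) :
    IsRecognisable S ↔ FiniteDimensional k (SyntacticAlgebra S) := by
  exact ⟨IsRecognisable.finiteDimensional_syntacticAlgebra,
    fun _ => isRecognisable_of_finiteDimensional_syntacticAlgebra S⟩
end

section
/- Let k be a field and A a finite-dimensional associative unital k-algebra with dim_k(A) = N, and suppose A is Frobenius, i.e., there exists a linear functional λ : A → k whose kernel contains no left or right ideal other than {0}. Then A is rational syntactic: there exists a linear functional S : k⟨x₁,…,x_N⟩ → k on the free associative algebra on N generators such that A is isomorphic as a k-algebra to the syntactic algebra 𝔄_S = k⟨x₁,…,x_N⟩ / I_S, which is finite-dimensional. -/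
/-- A set `J` in a ring is a left ideal (set version). -/
def IsLeftIdealSet {A : Type*} [Ring A] (J : Set A) : Prop :=
  (0 : A) ∈ J ∧ (∀ x ∈ J, ∀ y ∈ J, x + y ∈ J) ∧ (∀ x ∈ J, -x ∈ J) ∧
    (∀ a : A, ∀ x ∈ J, a * x ∈ J)

/-- A set `J` in a ring is a right ideal (set version). -/
def IsRightIdealSet {A : Type*} [Ring A] (J : Set A) : Prop :=
  (0 : A) ∈ J ∧ (∀ x ∈ J, ∀ y ∈ J, x + y ∈ J) ∧ (∀ x ∈ J, -x ∈ J) ∧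
    (∀ a : A, ∀ x ∈ J, x * a ∈ J)

/-- If `lam` is a functional whose kernel contains no nonzero left ideal and `φ` is surjective,
then the syntactic congruence of `lam ∘ φ` is the kernel congruence of `φ`. -/
theorem syntacticCon_comp_eq_ker {k R A : Type*} [CommRing k] [Ring R] [Algebra k R] [Ring A]
    [Algebra k A] (lam : A →ₗ[k] k)
    (hleft : ∀ J : Set A, IsLeftIdealSet J → J ⊆ {x : A | lam x = 0} → J = {0})
    (φ : R →ₐ[k] A) (hφ : Function.Surjective φ) :
    syntacticCon (lam ∘ₗ φ.toLinearMap) = RingCon.ker (φ : R →+* A) := by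
  ext a b
  change (∀ u v : R, lam (φ (u * (a - b) * v)) = 0) ↔ φ a = φ b
  constructor
  · intro h
    have hJ := hleft {x | ∀ u : A, lam (u * x) = 0}
      ⟨by simp, fun x hx y hy u => by rw [mul_add, map_add, hx u, hy u, add_zero],
        fun x hx u => by rw [mul_neg, map_neg, hx u, neg_zero],
        fun c x hx u => by rw [← mul_assoc]; exact hx (u * c)⟩
      (fun x hx => by simpa using hx 1)
    have hmem : φ a - φ b ∈ {x | ∀ u : A, lam (u * x) = 0} := by
      intro u
      obtain ⟨w, rfl⟩ := hφ u
      simpa using h w 1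
    rw [hJ] at hmem
    exact sub_eq_zero.mp hmem
  · intro h u v
    simp [h]

/-- The canonical map from the free algebra on a basis of `A` to `A` is surjective. -/
theorem FreeAlgebra.lift_basis_surjective {k A ι : Type*} [CommRing k] [Ring A] [Algebra k A]
    (b : Module.Basis ι k A) : Function.Surjective (FreeAlgebra.lift k b) := by
  rw [← AlgHom.coe_toLinearMap, ← LinearMap.range_eq_top, eq_top_iff, ← b.span_eq,
    Submodule.span_le]
  rintro _ ⟨i, rfl⟩
  exact ⟨FreeAlgebra.ι k i, by simp⟩

/-- Let `A` be a `k`-algebra with `dim_k A = N` which is Frobenius, i.e. admits a linear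
functional `lam : A → k` whose kernel contains no left or right ideal other than `{0}`.
Then `A` is rational syntactic: there is a formal series `S : k⟨x₁,…,x_N⟩ → k` such that
`A` is isomorphic as a `k`-algebra to the syntactic algebra `𝔄_S = k⟨x₁,…,x_N⟩ / I_S`,
which is finite-dimensional. -/
theorem frobenius_is_rational_syntactic
    {k A : Type*} [Field k] [Ring A] [Algebra k A] [FiniteDimensional k A] {N : ℕ}
    (hdim : Module.finrank k A = N)
    (lam : A →ₗ[k] k)
    (hleft : ∀ J : Set A, IsLeftIdealSet J → J ⊆ {x : A | lam x = 0} → J = {0})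
    (hright : ∀ J : Set A, IsRightIdealSet J → J ⊆ {x : A | lam x = 0} → J = {0}) :
    ∃ S : FreeAlgebra k (Fin N) →ₗ[k] k,
      Nonempty (A ≃ₐ[k] SyntacticAlgebra S) ∧ FiniteDimensional k (SyntacticAlgebra S) := by
  let φ := FreeAlgebra.lift k (Module.finBasisOfFinrankEq k A hdim)
  have hφ : Function.Surjective φ := FreeAlgebra.lift_basis_surjective _
  let e : SyntacticAlgebra (lam ∘ₗ φ.toLinearMap) ≃+* A :=
    (RingCon.congr (RingEquiv.refl _) (syntacticCon_comp_eq_ker lam hleft φ hφ)).trans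
      (RingCon.quotientKerEquivOfSurjective (φ : FreeAlgebra k (Fin N) →+* A) hφ)
  let E : SyntacticAlgebra (lam ∘ₗ φ.toLinearMap) ≃ₐ[k] A :=
    AlgEquiv.ofRingEquiv (f := e) fun r => φ.commutes r
  exact ⟨lam ∘ₗ φ.toLinearMap, ⟨E.symm⟩, Module.Finite.equiv E.symm.toLinearEquiv⟩
end

section
/- Let k be a field of characteristic zero and A a finite-dimensional semisimple associative unital k-algebra with dim_k(A) = N. Then A is rational syntactic: there exists a linear functional S : k⟨x₁,…,x_N⟩ → k on the free associative algebra on N generators such that A is isomorphic as a k-algebra to the syntactic algebra 𝔄_S = k⟨x₁,…,x_N⟩ / I_S, which is finite-dimensional. -/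
/-- The trace form of a finite-dimensional semisimple algebra in characteristic zero is
nondegenerate. -/
theorem eq_zero_of_forall_trace_mulLeft_mul_eq_zero {k A : Type*} [Field k] [CharZero k] [Ring A]
    [Algebra k A] [FiniteDimensional k A] [IsSemisimpleRing A] {x : A}
    (h : ∀ u : A, LinearMap.trace k A (LinearMap.mulLeft k (u * x)) = 0) : x = 0 := by
  obtain ⟨e, he, hspan⟩ := IsSemisimpleRing.ideal_eq_span_idempotent (Ideal.span {x})
  obtain ⟨u, rfl⟩ : ∃ u, u * x = e :=
    Ideal.mem_span_singleton'.mp (hspan ▸ Ideal.mem_span_singleton_self e)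
  have hidem : IsIdempotentElem (LinearMap.mulLeft k (u * x)) := by
    rw [IsIdempotentElem, Module.End.mul_eq_comp, ← LinearMap.mulLeft_mul, he.eq]
  have hzero : u * x = 0 :=
    (LinearMap.mulLeft_eq_zero_iff k A _).mp
      (LinearMap.IsIdempotentElem.eq_zero_of_trace_eq_zero hidem (h u))
  rw [hzero] at hspan
  simpa using hspan

/-- If no nonzero two-sided ideal of `A` lies in the kernel of `f`, then `A` is the syntactic
algebra of the pullback of `f` along any surjective algebra homomorphism onto `A`. -/
noncomputable def SyntacticAlgebra.equivOfSurjective {k R A : Type*} [CommRing k] [Ring R]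
    [Algebra k R] [Ring A] [Algebra k A] (φ : R →ₐ[k] A) (hφ : Function.Surjective φ)
    (f : A →ₗ[k] k) (hf : ∀ x : A, (∀ u v : A, f (u * x * v) = 0) → x = 0) :
    SyntacticAlgebra (f ∘ₗ φ.toLinearMap) ≃ₐ[k] A :=
  have hker : syntacticCon (f ∘ₗ φ.toLinearMap) = RingCon.ker (φ : R →+* A) := by
    ext a b
    refine ⟨fun h => ?_, fun h u v => ?_⟩
    · refine sub_eq_zero.mp (hf _ fun u v => ?_)
      obtain ⟨u, rfl⟩ := hφ u
      obtain ⟨v, rfl⟩ := hφ v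
      simpa using h u v
    · have hab : φ a = φ b := h
      simp [hab]
  AlgEquiv.ofBijective
    { (syntacticCon (f ∘ₗ φ.toLinearMap)).lift (φ : R →+* A) hker.le with
      commutes' := fun c => φ.commutes c }
    (RingCon.lift_bijective_iff.mpr ⟨hker, hφ⟩)

/-- Let `k` be a field of characteristic zero and `A` a finite-dimensional semisimple
`k`-algebra with `dim_k A = N`.  Then `A` is rational syntactic: there is a formal series
`S : k⟨x₁,…,x_N⟩ → k` such that `A` is isomorphic as a `k`-algebra to the syntactic
algebra `𝔄_S = k⟨x₁,…,x_N⟩ / I_S`, which is finite-dimensional. -/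
theorem semisimple_is_rational_syntactic
    {k A : Type*} [Field k] [CharZero k] [Ring A] [Algebra k A]
    [FiniteDimensional k A] [IsSemisimpleRing A] {N : ℕ}
    (hdim : Module.finrank k A = N) :
    ∃ S : FreeAlgebra k (Fin N) →ₗ[k] k,
      Nonempty (A ≃ₐ[k] SyntacticAlgebra S) ∧ FiniteDimensional k (SyntacticAlgebra S) := by
  let b := Module.finBasisOfFinrankEq k A hdim
  have hφ : Function.Surjective (FreeAlgebra.lift k b) := by
    rw [← AlgHom.range_eq_top, ← Algebra.adjoin_range_eq_range_freeAlgebra_lift,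
      ← Algebra.toSubmodule_eq_top, eq_top_iff, ← b.span_eq]
    exact Algebra.span_le_adjoin k _
  let e := SyntacticAlgebra.equivOfSurjective (FreeAlgebra.lift k b) hφ
    (LinearMap.trace k A ∘ₗ (Algebra.lmul k A).toLinearMap) fun x hx =>
      eq_zero_of_forall_trace_mulLeft_mul_eq_zero fun u => mul_one (u * x) ▸ hx u 1
  exact ⟨_, ⟨e.symm⟩, Module.Finite.equiv e.symm.toLinearEquiv⟩
end

section
/- Let k be a field, X a finite alphabet, and S : X* → k a formal series, extended to a linear functional on the free associative algebra k⟨X⟩. Then S is exchangeable (i.e., S(v) = S(w) whenever the words v, w ∈ X* have the same commutative image) if and only if the syntactic algebra 𝔄_S = k⟨X⟩ / I_S is commutative. -/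
theorem syntacticCon_mk'_eq_iff {k R : Type*} [CommRing k] [Ring R] [Algebra k R]
    (S : R →ₗ[k] k) (a b : R) :
    (syntacticCon S).mk' a = (syntacticCon S).mk' b ↔ ∀ u v : R, S (u * (a - b) * v) = 0 :=
  (syntacticCon S).eq

theorem FreeMonoid.map_eq_of_perm {X M : Type*} [Monoid M] (f : FreeMonoid X →* M)
    (comm : ∀ v w, f v * f w = f w * f v) {v w : FreeMonoid X}
    (h : v.toList.Perm w.toList) : f v = f w := by
  rw [← FreeMonoid.lift_restrict f, FreeMonoid.lift_apply, FreeMonoid.lift_apply]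
  refine (h.map _).prod_eq' (List.pairwise_of_forall_mem_list ?_)
  simp only [List.mem_map]
  rintro _ ⟨x, -, rfl⟩ _ ⟨y, -, rfl⟩
  exact comm _ _

theorem map_mul_mul_mul_comm_of_exchangeable {k X : Type*} [CommRing k]
    (S : MonoidAlgebra k (FreeMonoid X) →ₗ[k] k)
    (hS : ∀ v w : FreeMonoid X, (v.toList : Multiset X) = (w.toList : Multiset X) →
      S (MonoidAlgebra.of k (FreeMonoid X) v) = S (MonoidAlgebra.of k (FreeMonoid X) w))
    (u a b v : MonoidAlgebra k (FreeMonoid X)) :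
    S (u * (a * b) * v) = S (u * (b * a) * v) := by
  induction u using MonoidAlgebra.induction_on with
  | add x y hx hy => simp only [add_mul, map_add, hx, hy]
  | smul r x hx => simp only [smul_mul_assoc, map_smul, hx]
  | of u =>
  induction v using MonoidAlgebra.induction_on with
  | add x y hx hy => simp only [mul_add, map_add, hx, hy]
  | smul r x hx => simp only [mul_smul_comm, map_smul, hx]
  | of v =>
  induction a using MonoidAlgebra.induction_on with
  | add x y hx hy => simp only [add_mul, mul_add, map_add, hx, hy]
  | smul r x hx => simp only [smul_mul_assoc, mul_smul_comm, map_smul, hx]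
  | of a =>
  induction b using MonoidAlgebra.induction_on with
  | add x y hx hy => simp only [add_mul, mul_add, map_add, hx, hy]
  | smul r x hx => simp only [smul_mul_assoc, mul_smul_comm, map_smul, hx]
  | of b =>
  simp only [← map_mul]
  apply hS
  simp only [FreeMonoid.toList_mul, ← Multiset.coe_add]
  rw [add_comm (a.toList : Multiset X)]

/-- A formal series `S` over a finite alphabet `X` is exchangeable — i.e. `S(v) = S(w)`
whenever the words `v, w ∈ X*` have the same commutative image (the same multiset of
letters) — if and only if its syntactic algebra `𝔄_S = k⟨X⟩ / I_S` is commutative. -/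
theorem exchangeable_iff_syntacticAlgebra_commutative
    {k X : Type*} [Field k] [Fintype X]
    (S : MonoidAlgebra k (FreeMonoid X) →ₗ[k] k) :
    (∀ v w : FreeMonoid X, (v.toList : Multiset X) = (w.toList : Multiset X) →
        S (MonoidAlgebra.of k (FreeMonoid X) v) = S (MonoidAlgebra.of k (FreeMonoid X) w)) ↔
      (∀ a b : SyntacticAlgebra S, a * b = b * a) := by
  constructor
  · intro hS a b
    obtain ⟨a, rfl⟩ := (syntacticCon S).mk'_surjective a
    obtain ⟨b, rfl⟩ := (syntacticCon S).mk'_surjective b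
    rw [← map_mul, ← map_mul, syntacticCon_mk'_eq_iff]
    intro u v
    rw [mul_sub, sub_mul, map_sub, map_mul_mul_mul_comm_of_exchangeable S hS, sub_self]
  · intro comm v w h
    have key := FreeMonoid.map_eq_of_perm
      ((syntacticCon S).mk'.toMonoidHom.comp (MonoidAlgebra.of k (FreeMonoid X)))
      (fun _ _ => comm _ _) (Multiset.coe_eq_coe.mp h)
    simpa [sub_eq_zero] using (syntacticCon_mk'_eq_iff S _ _).mp key 1 1
end

section
/- Let G be a finite group, regard its underlying set as a finite alphabet, and let j_G : G* → G be the monoid homomorphism from the free monoid on the set G sending each letter g to the group element g. Let M := j_G^{-1}(e) be the submonoid of G* of words multiplying to the identity e, and let C_G := (M \ {1}) \ (M \ {1})² be the set of nonempty words of M that are not products of two nonempty words of M. Then C_G is a code generating M (i.e., M is a free monoid with base C_G), and C_G is biprefix. -/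
/-- Free monoids are equidivisible. -/
theorem FreeMonoid.mul_eq_mul_cases {α : Type*} {a b c d : FreeMonoid α}
    (h : a * b = c * d) :
    (∃ t, c = a * t ∧ b = t * d) ∨ (∃ t, a = c * t ∧ d = t * b) :=
  List.append_eq_append_iff.mp h

/-- A prefix set of nonempty words is a code. -/
theorem FreeMonoid.eq_of_prod_eq_of_prefix {α : Type*} {C : Set (FreeMonoid α)}
    (one_notMem : (1 : FreeMonoid α) ∉ C)
    (hprefix : ∀ u v : FreeMonoid α, u ∈ C → u * v ∈ C → v = 1)
    (l l' : List (FreeMonoid α)) (hl : ∀ x ∈ l, x ∈ C) (hl' : ∀ x ∈ l', x ∈ C)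
    (h : l.prod = l'.prod) : l = l' := by
  have ne_one {x : FreeMonoid α} (hx : x ∈ C) : x ≠ 1 := fun h1 => one_notMem (h1 ▸ hx)
  induction l generalizing l' with
  | nil =>
    cases l' with
    | nil => rfl
    | cons b l' =>
      rw [List.prod_nil, List.prod_cons] at h
      exact absurd (List.append_eq_nil_iff.mp h.symm).1 (ne_one (hl' b (by simp)))
  | cons a l ih =>
    cases l' with
    | nil =>
      rw [List.prod_nil, List.prod_cons] at h
      exact absurd (List.append_eq_nil_iff.mp h).1 (ne_one (hl a (by simp)))
    | cons b l' =>
      rw [List.prod_cons, List.prod_cons] at h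
      have ha : a ∈ C := hl a (by simp)
      have hb : b ∈ C := hl' b (by simp)
      have hab : a = b := by
        rcases FreeMonoid.mul_eq_mul_cases h with ⟨t, rfl, -⟩ | ⟨t, rfl, -⟩
        · rw [hprefix a t ha hb, mul_one]
        · rw [hprefix b t hb ha, mul_one]
      subst hab
      rw [ih l' (fun x hx => hl x (List.mem_cons_of_mem _ hx))
        (fun x hx => hl' x (List.mem_cons_of_mem _ hx)) (mul_left_cancel h)]

/-- A submonoid of a free monoid is generated by its indecomposable elements. -/
theorem FreeMonoid.mem_closure_indecomposables {α : Type*} (M : Submonoid (FreeMonoid α))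
    (w : FreeMonoid α) (hw : w ∈ M) :
    w ∈ Submonoid.closure {w : FreeMonoid α | w ∈ M ∧ w ≠ 1 ∧
      ¬∃ u v : FreeMonoid α, u ∈ M ∧ u ≠ 1 ∧ v ∈ M ∧ v ≠ 1 ∧ w = u * v} := by
  induction hn : w.length using Nat.strong_induction_on generalizing w with
  | _ n ih =>
    by_cases h1 : w = 1
    · rw [h1]
      exact one_mem _
    by_cases hdec : ∃ u v : FreeMonoid α, u ∈ M ∧ u ≠ 1 ∧ v ∈ M ∧ v ≠ 1 ∧ w = u * v
    · obtain ⟨u, v, hu, hu1, hv, hv1, rfl⟩ := hdec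
      have hul : u.length ≠ 0 := fun h => hu1 (FreeMonoid.length_eq_zero.mp h)
      have hvl : v.length ≠ 0 := fun h => hv1 (FreeMonoid.length_eq_zero.mp h)
      rw [FreeMonoid.length_mul] at hn
      exact mul_mem (ih _ (by omega) u hu rfl) (ih _ (by omega) v hv rfl)
    · exact Submonoid.subset_closure ⟨hw, h1, hdec⟩


/-- Let `G` be a finite group, `j_G : G* → G` the monoid homomorphism from the free
monoid on the underlying set of `G` sending each letter `g` to the group element `g`,
`M := j_G⁻¹(e)` the submonoid of words multiplying to the identity, and
`C_G := (M \ {1}) \ (M \ {1})²` the set of nonempty words of `M` which are not products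
of two nonempty words of `M`.  Then `C_G` is a code generating `M` (i.e. `M` is a free
monoid with base `C_G`), and `C_G` is biprefix. -/
theorem group_code_is_biprefix_code
    {G : Type*} [Group G] [Fintype G]
    (j : FreeMonoid G →* G) (hj : ∀ g : G, j (FreeMonoid.of g) = g)
    (M : Set (FreeMonoid G)) (hM : M = {w : FreeMonoid G | j w = 1})
    (C : Set (FreeMonoid G))
    (hC : C = {w : FreeMonoid G | w ∈ M ∧ w ≠ 1 ∧
      ¬∃ u v : FreeMonoid G, u ∈ M ∧ u ≠ 1 ∧ v ∈ M ∧ v ≠ 1 ∧ w = u * v}) :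
    -- `C` generates `M`:
    ((Submonoid.closure C : Submonoid (FreeMonoid G)) : Set (FreeMonoid G)) = M ∧
    -- `C` is a code: no empty word, and unique factorization into elements of `C`:
    (1 : FreeMonoid G) ∉ C ∧
    (∀ l l' : List (FreeMonoid G), (∀ x ∈ l, x ∈ C) → (∀ x ∈ l', x ∈ C) →
      l.prod = l'.prod → l = l') ∧
    -- `C` is prefix:
    (∀ u v : FreeMonoid G, u ∈ C → u * v ∈ C → v = 1) ∧
    -- `C` is suffix:
    (∀ u v : FreeMonoid G, v ∈ C → u * v ∈ C → u = 1) := by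
  have one_notMem : (1 : FreeMonoid G) ∉ C := by
    rw [hC]
    exact fun h => h.2.1 rfl
  have hprefix : ∀ u v : FreeMonoid G, u ∈ C → u * v ∈ C → v = 1 := by
    rw [hC, hM]
    rintro u v ⟨hu, hu1, -⟩ ⟨huv, -, hdec⟩
    simp only [Set.mem_ofPred_eq] at hu huv
    have hv : j v = 1 := by rwa [map_mul, hu, one_mul] at huv
    by_contra hv1
    exact hdec ⟨u, v, hu, hu1, hv, hv1, rfl⟩
  have hsuffix : ∀ u v : FreeMonoid G, v ∈ C → u * v ∈ C → u = 1 := by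
    rw [hC, hM]
    rintro u v ⟨hv, hv1, -⟩ ⟨huv, -, hdec⟩
    simp only [Set.mem_ofPred_eq] at hv huv
    have hu : j u = 1 := by rwa [map_mul, hv, mul_one] at huv
    by_contra hu1
    exact hdec ⟨u, v, hu, hu1, hv, hv1, rfl⟩
  refine ⟨?_, one_notMem, FreeMonoid.eq_of_prod_eq_of_prefix one_notMem hprefix,
    hprefix, hsuffix⟩
  rw [hC, hM]
  apply Set.Subset.antisymm
  · exact (Submonoid.closure_le (S := MonoidHom.mker j)).mpr fun w hw => hw.1
  · exact FreeMonoid.mem_closure_indecomposables (MonoidHom.mker j)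
end
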